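/- arXiv:2012.01238 — 2 statements merged into one kernel-verified Lean document; each statement's English description precedes it below -/
import Mathlib

section
/- Fix α > 1, β > 0 and k ∈ {0,1,2}. Define a_n = (β|t|)^n/n! · Γ(1 + (n+k)/α) for t ∈ ℝ. Then lim_{n→∞} |a_{n+1}/a_n| = 0, and hence the series Σ_{n=0}^∞ a_n converges for every t ∈ ℝ. -/
open Real Filter

theorem Real.Gamma_add_le_Gamma_mul_rpow {x s : ℝ} (hx : 0 < x) (hs₀ : 0 < s) (hs₁ : s < 1) :
    Gamma (x + s) ≤ Gamma x * x ^ s := by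
  have hG := Gamma_pos_of_pos hx
  calc Gamma (x + s) = Gamma ((1 - s) * x + s * (x + 1)) := by ring_nf
    _ ≤ Gamma x ^ (1 - s) * Gamma (x + 1) ^ s :=
      Gamma_mul_add_mul_le_rpow_Gamma_mul_rpow_Gamma hx (by linarith) (by linarith) hs₀ (by ring)
    _ = Gamma x ^ (1 - s) * Gamma x ^ s * x ^ s := by
      rw [Gamma_add_one hx.ne', mul_rpow hx.le hG.le]
      ring
    _ = Gamma x * x ^ s := by
      rw [← rpow_add hG, sub_add_cancel, rpow_one]

theorem abs_ratio_pow_div_factorial_mul_Gamma_le {α c : ℝ} (hα : 1 < α) (hc : 0 ≤ c) (k n : ℕ) :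
    |(c ^ (n + 1) / ((n + 1).factorial : ℝ) * Gamma (1 + ((n : ℝ) + 1 + k) / α))
      / (c ^ n / (n.factorial : ℝ) * Gamma (1 + ((n : ℝ) + k) / α))|
      ≤ c * (1 + k) ^ (1 / α) * ((n : ℝ) + 1) ^ (-(1 - 1 / α)) := by
  have hα₀ : 0 < α := by linarith
  have hs₀ : 0 < 1 / α := by positivity
  have hs₁ : 1 / α < 1 := (div_lt_one hα₀).2 hα
  set x : ℝ := 1 + ((n : ℝ) + k) / α with hx
  have hx₀ : 0 < x := by positivity
  have hn₀ : (0 : ℝ) < n + 1 := by positivity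
  have hxs : 1 + ((n : ℝ) + 1 + k) / α = x + 1 / α := by rw [hx]; ring
  have hG := Gamma_pos_of_pos hx₀
  have hGs : 0 < Gamma (x + 1 / α) := Gamma_pos_of_pos (by positivity)
  rw [hxs, abs_of_nonneg (by positivity)]
  rcases hc.eq_or_lt with rfl | hc
  · simp
  have hx_le : x ≤ (1 + k) * (n + 1) := by
    have : ((n : ℝ) + k) / α ≤ n + k := div_le_self (by positivity) hα.le
    have : (0 : ℝ) ≤ k * n := by positivity
    linarith
  calc c ^ (n + 1) / ((n + 1).factorial : ℝ) * Gamma (x + 1 / α)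
        / (c ^ n / (n.factorial : ℝ) * Gamma x)
      = c / (n + 1) * (Gamma (x + 1 / α) / Gamma x) := by
        rw [Nat.factorial_succ]
        push_cast
        field_simp
        ring
    _ ≤ c / (n + 1) * ((1 + k) * (n + 1)) ^ (1 / α) := by
        gcongr
        calc Gamma (x + 1 / α) / Gamma x ≤ x ^ (1 / α) :=
              (div_le_iff₀' hG).2 (Gamma_add_le_Gamma_mul_rpow hx₀ hs₀ hs₁)
          _ ≤ _ := by gcongr
    _ = c * (1 + k) ^ (1 / α) * ((n : ℝ) + 1) ^ (-(1 - 1 / α)) := by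
        rw [mul_rpow (by positivity) hn₀.le, neg_sub, rpow_sub_one hn₀.ne']
        ring

theorem stmt_12 (α β : ℝ) (hα : 1 < α) (hβ : 0 < β) (k : ℕ) (hk : k ≤ 2) (t : ℝ) :
    Filter.Tendsto
      (fun n : ℕ =>
        |((β*|t|)^(n+1) / ((n+1).factorial : ℝ) * Real.Gamma (1 + ((n:ℝ)+1+k)/α))
          / ((β*|t|)^n / (n.factorial : ℝ) * Real.Gamma (1 + ((n:ℝ)+k)/α))|)
      Filter.atTop (nhds 0) ∧
    Summable (fun n : ℕ =>
      (β*|t|)^n / (n.factorial : ℝ) * Real.Gamma (1 + ((n:ℝ)+k)/α)) := by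
  have hα₀ : 0 < α := by linarith
  have hc : 0 ≤ β * |t| := by positivity
  generalize β * |t| = c at hc ⊢
  have hbound : Tendsto
      (fun n : ℕ => c * (1 + k) ^ (1 / α) * ((n : ℝ) + 1) ^ (-(1 - 1 / α))) atTop (nhds 0) := by
    have hs : 0 < 1 - 1 / α := sub_pos.2 ((div_lt_one hα₀).2 hα)
    simpa using ((tendsto_rpow_neg_atTop hs).comp
      (tendsto_atTop_add_const_right _ 1 tendsto_natCast_atTop_atTop)).const_mul
        (c * (1 + k) ^ (1 / α))
  have hratio := squeeze_zero (fun _ => abs_nonneg _)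
    (abs_ratio_pow_div_factorial_mul_Gamma_le hα hc k) hbound
  refine ⟨hratio, ?_⟩
  rcases hc.eq_or_lt with rfl | hc
  · refine summable_of_ne_finset_zero (s := {0}) fun n hn => ?_
    simp [Finset.notMem_singleton.1 hn]
  · refine summable_of_ratio_test_tendsto_lt_one zero_lt_one (Eventually.of_forall fun n => ?_) ?_
    · have : 0 < Gamma (1 + ((n : ℝ) + k) / α) := Gamma_pos_of_pos (by positivity)
      positivity
    · simpa only [norm_eq_abs, abs_div, Nat.cast_add_one] using hratio
end

section
/- Let X have the bimodal Weibull density with α = 1 and δ > 0. Then every critical point x > 0 of the density satisfies δ²x² - 2δ(1+βδ)x + 2(1+βδ) = 0; in particular the density has at most two critical points on (0,∞), so it is either unimodal or strictly decreasing. -/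
open Real MeasureTheory Set Filter

noncomputable def bwPdf (α β δ : ℝ) (x : ℝ) : ℝ :=
  (α / (β * (2 + δ^2*β^2*Real.Gamma (1+2/α) - 2*δ*β*Real.Gamma (1+1/α)))) *
    (1+(1-δ*x)^2) * (x/β)^(α-1) * Real.exp (-(x/β)^α)

lemma bwPdf_one (β δ x : ℝ) :
    bwPdf 1 β δ x = 1 / (β * (2 + 2 * δ^2 * β^2 - 2 * δ * β)) *
      (1 + (1 - δ * x)^2) * Real.exp (-(x / β)) := by
  have h3 : Real.Gamma 3 = 2 := by
    rw [show (3 : ℝ) = 2 + 1 by norm_num, Real.Gamma_add_one two_ne_zero, Real.Gamma_two, mul_one]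
  have e3 : (1 : ℝ) + 2 / 1 = 3 := by norm_num
  have e2 : (1 : ℝ) + 1 / 1 = 2 := by norm_num
  rw [bwPdf, e3, e2, h3, Real.Gamma_two, sub_self, Real.rpow_zero, Real.rpow_one]
  ring_nf

lemma hasDerivAt_bwPdf_one {β : ℝ} (hβ : β ≠ 0) (δ x : ℝ) :
    HasDerivAt (bwPdf 1 β δ)
      (-(1 / (β * (2 + 2 * δ^2 * β^2 - 2 * δ * β)) * Real.exp (-(x / β)) / β *
        (δ^2 * x^2 - 2 * δ * (1 + β * δ) * x + 2 * (1 + β * δ)))) x := by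
  rw [funext (bwPdf_one β δ)]
  have hlin : HasDerivAt (fun y : ℝ => 1 - δ * y) (-δ) x := by
    simpa using ((hasDerivAt_id x).const_mul δ).const_sub 1
  have hexp : HasDerivAt (fun y : ℝ => Real.exp (-(y / β)))
      (Real.exp (-(x / β)) * (-(1 / β))) x :=
    ((hasDerivAt_id x).div_const β).neg.exp
  have hprod := (((hlin.pow 2).const_add 1).const_mul
    (1 / (β * (2 + 2 * δ^2 * β^2 - 2 * δ * β)))).mul hexp
  refine hprod.congr_deriv ?_
  generalize 1 / (β * (2 + 2 * δ^2 * β^2 - 2 * δ * β)) = c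
  simp only [Pi.pow_apply]
  field_simp
  push_cast
  ring

lemma quadratic_of_deriv_bwPdf_one_eq_zero {β δ x : ℝ} (hβ : 0 < β)
    (h : deriv (bwPdf 1 β δ) x = 0) :
    δ^2 * x^2 - 2 * δ * (1 + β * δ) * x + 2 * (1 + β * δ) = 0 := by
  have hZ : 0 < 2 + 2 * δ^2 * β^2 - 2 * δ * β := by
    nlinarith [sq_nonneg (δ * β - 1), sq_nonneg (δ * β)]
  rw [(hasDerivAt_bwPdf_one hβ.ne' δ x).deriv, neg_eq_zero] at h
  exact (mul_eq_zero.mp h).resolve_left (by positivity)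

lemma encard_quadratic_roots_le_two {a : ℝ} (ha : a ≠ 0) (b c : ℝ) :
    {x : ℝ | a * x^2 + b * x + c = 0}.encard ≤ 2 := by
  rcases Set.eq_empty_or_nonempty {x : ℝ | a * x^2 + b * x + c = 0} with he | ⟨r, hr⟩
  · simp [he]
  · have hpair : ({r, -b / a - r} : Set ℝ).encard ≤ 2 :=
      (Set.encard_insert_le _ _).trans (by rw [Set.encard_singleton, one_add_one_eq_two])
    refine (Set.encard_le_encard fun x hx => ?_).trans hpair
    simp only [Set.mem_ofPred_eq] at hr hx
    have hfac : (x - r) * (a * (x + r) + b) = 0 := by linear_combination hx - hr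
    rcases mul_eq_zero.mp hfac with h | h
    · exact Or.inl (sub_eq_zero.mp h)
    · right
      rw [Set.mem_singleton_iff, eq_sub_iff_add_eq, eq_div_iff ha]
      linear_combination h

theorem stmt_17 (β δ : ℝ) (hβ : 0 < β) (hδ : 0 < δ) :
    (∀ x : ℝ, 0 < x → deriv (bwPdf 1 β δ) x = 0 →
        δ^2*x^2 - 2*δ*(1+β*δ)*x + 2*(1+β*δ) = 0) ∧
    {x : ℝ | 0 < x ∧ deriv (bwPdf 1 β δ) x = 0}.encard ≤ 2 := by
  refine ⟨fun x _ h => quadratic_of_deriv_bwPdf_one_eq_zero hβ h, ?_⟩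
  refine (Set.encard_le_encard fun x hx => ?_).trans
    (encard_quadratic_roots_le_two (pow_ne_zero 2 hδ.ne')
      (-(2 * δ * (1 + β * δ))) (2 * (1 + β * δ)))
  have h := quadratic_of_deriv_bwPdf_one_eq_zero hβ hx.2
  rw [Set.mem_ofPred_eq]
  linear_combination h
end
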